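/- arXiv:2004.13975 — 6 statements merged into one kernel-verified Lean document; each statement's English description precedes it below -/
import Mathlib

section
/- Let A ∈ ℝ^{m×n}, B ∈ ℝ^{p×n}, let X̃ ∈ ℝ^{n×k} satisfy X̃^TX̃ = I_k, and suppose AX̃ = ŨG and BX̃ = ṼH with Ũ ∈ ℝ^{m×k}, Ṽ ∈ ℝ^{p×k} satisfying Ũ^TŨ = Ṽ^TṼ = I_k and G, H ∈ ℝ^{k×k}. For e, f, d ∈ ℝ^k, scalars α̃, β̃ ∈ ℝ, and ũ = Ũe, ṽ = Ṽf, x̃ = X̃d, the three conditions Ax̃ = α̃ũ, Bx̃ = β̃ṽ, and X̃^T(β̃A^Tũ − α̃B^Tṽ) = 0 hold simultaneously if and only if Gd = α̃e, Hd = β̃f, and β̃G^Te = α̃H^Tf hold simultaneously. -/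
open Matrix

theorem stmt3 {m n p k : ℕ} (A : Matrix (Fin m) (Fin n) ℝ) (B : Matrix (Fin p) (Fin n) ℝ)
    (Xt : Matrix (Fin n) (Fin k) ℝ)
    (Ut : Matrix (Fin m) (Fin k) ℝ) (Vt : Matrix (Fin p) (Fin k) ℝ)
    (G H : Matrix (Fin k) (Fin k) ℝ)
    (hXt : Xtᵀ * Xt = 1) (hUt : Utᵀ * Ut = 1) (hVt : Vtᵀ * Vt = 1)
    (hAX : A * Xt = Ut * G) (hBX : B * Xt = Vt * H)
    (e f d : Fin k → ℝ) (αt βt : ℝ)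
    (ut : Fin m → ℝ) (vt : Fin p → ℝ) (xt : Fin n → ℝ)
    (hut : ut = Ut.mulVec e) (hvt : vt = Vt.mulVec f) (hxt : xt = Xt.mulVec d) :
    (A.mulVec xt = αt • ut ∧ B.mulVec xt = βt • vt ∧
      Xtᵀ.mulVec (βt • Aᵀ.mulVec ut - αt • Bᵀ.mulVec vt) = 0) ↔
    (G.mulVec d = αt • e ∧ H.mulVec d = βt • f ∧
      βt • Gᵀ.mulVec e = αt • Hᵀ.mulVec f) := by
  subst hut hvt hxt
  have inj : ∀ {q : ℕ} (W : Matrix (Fin q) (Fin k) ℝ), Wᵀ * W = 1 →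
      ∀ x y : Fin k → ℝ, W.mulVec x = W.mulVec y ↔ x = y := by
    intro q W hW x y
    constructor
    · intro h
      have h2 := congrArg (fun z => Wᵀ.mulVec z) h
      simpa [Matrix.mulVec_mulVec, hW] using h2
    · intro h
      rw [h]
  have h1 : Xtᵀ * (Aᵀ * Ut) = Gᵀ := by
    rw [← Matrix.mul_assoc, ← Matrix.transpose_mul, hAX, Matrix.transpose_mul,
      Matrix.mul_assoc, hUt, Matrix.mul_one]
  have h2 : Xtᵀ * (Bᵀ * Vt) = Hᵀ := by
    rw [← Matrix.mul_assoc, ← Matrix.transpose_mul, hBX, Matrix.transpose_mul,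
      Matrix.mul_assoc, hVt, Matrix.mul_one]
  rw [Matrix.mulVec_sub, Matrix.mulVec_smul, Matrix.mulVec_smul]
  simp only [Matrix.mulVec_mulVec]
  rw [h1, h2, hAX, hBX, sub_eq_zero, ← Matrix.mulVec_mulVec, ← Matrix.mulVec_mulVec,
    ← Matrix.mulVec_smul, ← Matrix.mulVec_smul, inj Ut hUt, inj Vt hVt]
end

section
/- Assume q ≥ 2, set σ = σ₁ = α₁/β₁, and assume σ is simple (σ ≠ σ_i for i = 2,…,q). Partition X = [x, X₂] and Y = X^{-T} = [y, Y₂] with X₂, Y₂ ∈ ℝ^{n×(n−1)}, let Y₂ = Q_y R_y be a thin QR factorization (Q_y ∈ ℝ^{n×(n−1)} with Q_y^T Q_y = I, R_y ∈ ℝ^{(n−1)×(n−1)} invertible), let M' = X₂^T (A^TA − σ² B^TB) X₂, and let σ_* = σ_j where j ∈ {2,…,q} minimizes |α_i² − β_i²σ²| over i ∈ {2,…,q}. Then R_y M' R_y^T is invertible and κ(R_y M' R_y^T) ≤ κ(X)² · max{ max{1,σ²}·(1+σ_*²)/|σ_*² − σ²| , max{1,σ²}/min{1,σ²} }, where κ(M)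 := ‖M‖·‖M^{-1}‖ denotes the spectral condition number of an invertible matrix M. -/
open Matrix

/-- Euclidean norm of a vector. -/
noncomputable def enorm {ι : Type*} [Fintype ι] (x : ι → ℝ) : ℝ :=
  Real.sqrt (∑ i, x i ^ 2)

/-- Spectral (operator 2-) norm of a matrix. -/
noncomputable def specNorm {ι κ : Type*} [Fintype ι] [Fintype κ] [DecidableEq κ]
    (A : Matrix ι κ ℝ) : ℝ :=
  ‖LinearMap.toContinuousLinearMap (Matrix.toEuclideanLin A)‖

/-- Index type for columns of `A`, `B` (size `n = q + q₁ + q₂`). -/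
abbrev IdxN (q q₁ q₂ : ℕ) := Fin q ⊕ (Fin q₁ ⊕ Fin q₂)

/-- Index type for rows of `A` (size `m = q + l₁ + q₂`). -/
abbrev IdxM (q l₁ q₂ : ℕ) := Fin q ⊕ (Fin l₁ ⊕ Fin q₂)

/-- Index type for rows of `B` (size `p = q + q₁ + l₂`). -/
abbrev IdxP (q q₁ l₂ : ℕ) := Fin q ⊕ (Fin q₁ ⊕ Fin l₂)

/-- `Σ_A = diag(C, 0_{l₁×q₁}, I_{q₂})` with `C = diag(α₁,…,α_q)`. -/
def SigmaA (q q₁ q₂ l₁ : ℕ) (α : Fin q → ℝ) : Matrix (IdxM q l₁ q₂) (IdxN q q₁ q₂) ℝ :=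
  Matrix.fromBlocks (Matrix.diagonal α) 0 0 (Matrix.fromBlocks 0 0 0 1)

/-- `Σ_B = diag(S, I_{q₁}, 0_{l₂×q₂})` with `S = diag(β₁,…,β_q)`. -/
def SigmaB (q q₁ q₂ l₂ : ℕ) (β : Fin q → ℝ) : Matrix (IdxP q q₁ l₂) (IdxN q q₁ q₂) ℝ :=
  Matrix.fromBlocks (Matrix.diagonal β) 0 0 (Matrix.fromBlocks 1 0 0 0)

/-- Spectral condition number `κ(M) = ‖M‖·‖M⁻¹‖`. -/
noncomputable def specCond {ι : Type*} [Fintype ι] [DecidableEq ι]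
    (M : Matrix ι ι ℝ) : ℝ :=
  specNorm M * specNorm M⁻¹

open scoped Matrix.Norms.L2Operator in
theorem specNorm_eq' {ι κ : Type*} [Fintype ι] [Fintype κ] [DecidableEq κ]
    (A : Matrix ι κ ℝ) : specNorm A = ‖A‖ := rfl

open scoped Matrix.Norms.L2Operator in
theorem specNorm_nonneg' {ι κ : Type*} [Fintype ι] [Fintype κ] [DecidableEq κ]
    (A : Matrix ι κ ℝ) : 0 ≤ specNorm A := by
  rw [specNorm_eq']; exact norm_nonneg _

open scoped Matrix.Norms.L2Operator in
theorem specNorm_mul' {ι κ τ : Type*} [Fintype ι] [Fintype κ] [Fintype τ] [DecidableEq κ]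
    [DecidableEq τ] (A : Matrix ι κ ℝ) (B : Matrix κ τ ℝ) :
    specNorm (A * B) ≤ specNorm A * specNorm B := by
  simp only [specNorm_eq']; exact Matrix.l2_opNorm_mul A B

open scoped Matrix.Norms.L2Operator in
theorem specNorm_transpose' {ι κ : Type*} [Fintype ι] [Fintype κ] [DecidableEq ι] [DecidableEq κ]
    (A : Matrix ι κ ℝ) : specNorm Aᵀ = specNorm A := by
  simp only [specNorm_eq', ← Matrix.conjTranspose_eq_transpose_of_trivial]
  exact Matrix.l2_opNorm_conjTranspose A

open scoped Matrix.Norms.L2Operator in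
theorem specNorm_diagonal' {ι : Type*} [Fintype ι] [DecidableEq ι] (d : ι → ℝ) (c : ℝ)
    (hc : 0 ≤ c) (h : ∀ i, |d i| ≤ c) : specNorm (Matrix.diagonal d) ≤ c := by
  rw [specNorm_eq', Matrix.l2_opNorm_diagonal]
  exact (pi_norm_le_iff_of_nonneg hc).2 h

open scoped Matrix.Norms.L2Operator in
theorem specNorm_isom' {ι κ : Type*} [Fintype ι] [Fintype κ] [DecidableEq ι] [DecidableEq κ]
    (Q : Matrix ι κ ℝ) (h : Qᵀ * Q = 1) : specNorm Q ≤ 1 := by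
  have h1 : specNorm (1 : Matrix κ κ ℝ) ≤ 1 := by
    rw [← Matrix.diagonal_one]
    exact specNorm_diagonal' _ 1 zero_le_one (by simp)
  have h2 := Matrix.l2_opNorm_conjTranspose_mul_self Q
  rw [Matrix.conjTranspose_eq_transpose_of_trivial, h, ← specNorm_eq', ← specNorm_eq'] at h2
  nlinarith [specNorm_nonneg' Q]

theorem specNorm_cols' {ι κ : Type*} [Fintype ι] [Fintype κ] [DecidableEq ι] [DecidableEq κ]
    (X : Matrix ι ι ℝ) (f : κ → ι) (hf : Function.Injective f) :
    specNorm (X.submatrix id f) ≤ specNorm X := by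
  have h : X.submatrix id f = X * (1 : Matrix ι ι ℝ).submatrix id f := by
    ext i j; simp [Matrix.mul_apply, Matrix.one_apply]
  rw [h]
  have h2 : specNorm ((1 : Matrix ι ι ℝ).submatrix id f) ≤ 1 := by
    apply specNorm_isom'
    ext i j; simp [Matrix.mul_apply, Matrix.one_apply, hf.eq_iff, eq_comm]
  calc _ ≤ _ := specNorm_mul' _ _
    _ ≤ specNorm X * 1 := by gcongr; exact specNorm_nonneg' _
    _ = _ := mul_one _

/-- The diagonal entries of `Xᵀ (AᵀA - σ² BᵀB) X`. -/
noncomputable def dvec' (q q₁ q₂ : ℕ) (α β : Fin q → ℝ) (σ : ℝ) : IdxN q q₁ q₂ → ℝ :=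
  Sum.elim (fun i => α i ^ 2 - β i ^ 2 * σ ^ 2) (Sum.elim (fun _ => - σ ^ 2) (fun _ => 1))

theorem sigma_diag' (q q₁ q₂ l₁ l₂ : ℕ) (α β : Fin q → ℝ) (σ : ℝ) :
    (SigmaA q q₁ q₂ l₁ α)ᵀ * SigmaA q q₁ q₂ l₁ α
      - σ ^ 2 • ((SigmaB q q₁ q₂ l₂ β)ᵀ * SigmaB q q₁ q₂ l₂ β)
      = Matrix.diagonal (dvec' q q₁ q₂ α β σ) := by
  unfold SigmaA SigmaB dvec'
  simp only [Matrix.fromBlocks_transpose, Matrix.fromBlocks_multiply]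
  ext i j
  rcases i with i | i | i <;> rcases j with j | j | j <;>
    simp [Matrix.diagonal_apply, Matrix.one_apply]
  · split_ifs <;> simp_all <;> ring
  · split_ifs <;> simp

theorem gram' {m n : Type*} [Fintype m] [Fintype n] [DecidableEq m] 
    (U : Matrix m m ℝ) (A S : Matrix m n ℝ) (X : Matrix n n ℝ) (hU : Uᵀ * U = 1)
    (h : Uᵀ * A * X = S) : Xᵀ * (Aᵀ * A) * X = Sᵀ * S := by
  have hU' : U * Uᵀ = 1 := mul_eq_one_comm.1 hU
  rw [← h]
  simp only [Matrix.transpose_mul, Matrix.transpose_transpose, Matrix.mul_assoc]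
  rw [← Matrix.mul_assoc U Uᵀ, hU', Matrix.one_mul]

set_option maxHeartbeats 2000000 in
theorem stmt12 {q q₁ q₂ l₁ l₂ : ℕ} (hq : 0 < q) (hq2 : 2 ≤ q)
    (A : Matrix (IdxM q l₁ q₂) (IdxN q q₁ q₂) ℝ)
    (B : Matrix (IdxP q q₁ l₂) (IdxN q q₁ q₂) ℝ)
    (U : Matrix (IdxM q l₁ q₂) (IdxM q l₁ q₂) ℝ)
    (V : Matrix (IdxP q q₁ l₂) (IdxP q q₁ l₂) ℝ)
    (X : Matrix (IdxN q q₁ q₂) (IdxN q q₁ q₂) ℝ)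
    (α β : Fin q → ℝ)
    (hαpos : ∀ i, 0 < α i) (hα1 : ∀ i, α i < 1)
    (hβpos : ∀ i, 0 < β i) (hβ1 : ∀ i, β i < 1)
    (hαβ : ∀ i, α i ^ 2 + β i ^ 2 = 1)
    (hU : Uᵀ * U = 1) (hV : Vᵀ * V = 1) (hX : IsUnit X.det)
    (hA : Uᵀ * A * X = SigmaA q q₁ q₂ l₁ α)
    (hB : Vᵀ * B * X = SigmaB q q₁ q₂ l₂ β)
    (σ : ℝ) (hσ : σ = α ⟨0, hq⟩ / β ⟨0, hq⟩)
    (hsimple : ∀ i : Fin q, i ≠ ⟨0, hq⟩ → σ ≠ α i / β i)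
    (X₂ Y₂ : Matrix (IdxN q q₁ q₂) {j : IdxN q q₁ q₂ // j ≠ Sum.inl ⟨0, hq⟩} ℝ)
    (hX₂ : X₂ = X.submatrix id Subtype.val)
    (hY₂ : Y₂ = X⁻¹ᵀ.submatrix id Subtype.val)
    (Qy : Matrix (IdxN q q₁ q₂) {j : IdxN q q₁ q₂ // j ≠ Sum.inl ⟨0, hq⟩} ℝ)
    (Ry : Matrix {j : IdxN q q₁ q₂ // j ≠ Sum.inl ⟨0, hq⟩}
                 {j : IdxN q q₁ q₂ // j ≠ Sum.inl ⟨0, hq⟩} ℝ)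
    (hQy : Qyᵀ * Qy = 1) (hRy : IsUnit Ry.det) (hQR : Y₂ = Qy * Ry)
    (M' : Matrix {j : IdxN q q₁ q₂ // j ≠ Sum.inl ⟨0, hq⟩}
                 {j : IdxN q q₁ q₂ // j ≠ Sum.inl ⟨0, hq⟩} ℝ)
    (hM' : M' = X₂ᵀ * (Aᵀ * A - σ ^ 2 • (Bᵀ * B)) * X₂)
    (jstar : Fin q) (hjstar : jstar ≠ ⟨0, hq⟩)
    (hjmin : ∀ i : Fin q, i ≠ ⟨0, hq⟩ →
      |α jstar ^ 2 - β jstar ^ 2 * σ ^ 2| ≤ |α i ^ 2 - β i ^ 2 * σ ^ 2|)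
    (σs : ℝ) (hσs : σs = α jstar / β jstar) :
    IsUnit (Ry * M' * Ryᵀ) ∧
    specCond (Ry * M' * Ryᵀ) ≤ specCond X ^ 2 *
      max (max 1 (σ ^ 2) * (1 + σs ^ 2) / |σs ^ 2 - σ ^ 2|)
          (max 1 (σ ^ 2) / min 1 (σ ^ 2)) := by
  classical
  set d : {j : IdxN q q₁ q₂ // j ≠ Sum.inl ⟨0, hq⟩} → ℝ :=
    fun j => dvec' q q₁ q₂ α β σ j.1 with hd
  have hσpos : 0 < σ := by rw [hσ]; exact div_pos (hαpos _) (hβpos _)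
  have hσspos : 0 < σs := by rw [hσs]; exact div_pos (hαpos _) (hβpos _)
  -- the middle matrix is diagonal
  have hM : M' = Matrix.diagonal d := by
    have h1 : Xᵀ * (Aᵀ * A - σ ^ 2 • (Bᵀ * B)) * X
        = Matrix.diagonal (dvec' q q₁ q₂ α β σ) := by
      rw [← sigma_diag' q q₁ q₂ l₁ l₂, ← gram' U A _ X hU hA, ← gram' V B _ X hV hB]
      simp only [Matrix.mul_sub, Matrix.sub_mul, Matrix.mul_smul, Matrix.smul_mul]
    have h2 : M' = (Xᵀ * (Aᵀ * A - σ ^ 2 • (Bᵀ * B)) * X).submatrix Subtype.val Subtype.val := by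
      rw [hM', hX₂]; rfl
    rw [h2, h1]
    ext i j
    simp [Matrix.diagonal_apply, hd, Subtype.ext_iff]
  -- scalar bounds
  set dm : ℝ := α jstar ^ 2 - β jstar ^ 2 * σ ^ 2 with hdm
  have hαs : α jstar = σs * β jstar := by
    rw [hσs]; field_simp [(hβpos jstar).ne']
  have hdm' : dm * (1 + σs ^ 2) = σs ^ 2 - σ ^ 2 := by
    have hb : β jstar ^ 2 * (1 + σs ^ 2) = 1 := by
      have := hαβ jstar
      rw [hαs] at this; linarith
    have : dm = β jstar ^ 2 * (σs ^ 2 - σ ^ 2) := by rw [hdm, hαs]; ring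
    rw [this]; linear_combination (σs ^ 2 - σ ^ 2) * hb
  have hne : σs ^ 2 - σ ^ 2 ≠ 0 := by
    have h0 : σ ≠ σs := by rw [hσs]; exact hsimple _ hjstar
    intro h
    exact h0 ((sq_eq_sq₀ hσpos.le hσspos.le).1 (by linarith))
  have hdm0 : 0 < |dm| := by
    rw [abs_pos]; intro h; rw [h, zero_mul] at hdm'; exact hne hdm'.symm
  set K : ℝ := max 1 (σ ^ 2) with hK
  have hK1 : 1 ≤ K := le_max_left _ _
  have hKs : σ ^ 2 ≤ K := le_max_right _ _
  have hK0 : 0 < K := by linarith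
  set m : ℝ := min 1 (σ ^ 2) with hm
  have hm0 : 0 < m := lt_min one_pos (by positivity)
  have hup : ∀ j, |d j| ≤ K := by
    rintro ⟨i | i | i, hi⟩
    · simp only [hd, dvec', Sum.elim_inl]
      have := hαβ i
      rw [abs_le]
      constructor <;> nlinarith [sq_nonneg (α i), sq_nonneg (β i), sq_nonneg σ]
    · simpa [hd, dvec'] using hKs
    · simpa [hd, dvec'] using hK1
  have hlow : ∀ j, min |dm| m ≤ |d j| := by
    rintro ⟨i | i | i, hi⟩
    · exact (min_le_left _ _).trans (hjmin i (by simpa using hi))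
    · refine (min_le_right _ _).trans ((min_le_right _ _).trans ?_)
      simp [hd, dvec']
    · refine (min_le_right _ _).trans ((min_le_left _ _).trans ?_)
      simp [hd, dvec']
  have hmin0 : 0 < min |dm| m := lt_min hdm0 hm0
  have hd0 : ∀ j, d j ≠ 0 := fun j => abs_pos.1 (hmin0.trans_le (hlow j))
  set F : ℝ := max (K * (1 + σs ^ 2) / |σs ^ 2 - σ ^ 2|) (K / m) with hF
  have hKF : K * (min |dm| m)⁻¹ ≤ F := by
    rw [← div_eq_mul_inv]
    rcases min_choice |dm| m with h | h <;> rw [h]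
    · refine le_trans (le_of_eq ?_) (le_max_left _ _)
      have hp : 0 < 1 + σs ^ 2 := by positivity
      rw [← hdm', abs_mul, abs_of_pos hp]
      field_simp
    · exact le_max_right _ _
  -- norm bounds on Ry and its inverse
  have hRinv : (X₂ᵀ * Qy) * Ry = 1 := by
    rw [Matrix.mul_assoc, ← hQR, hX₂, hY₂]
    have h1 : Xᵀ * X⁻¹ᵀ = 1 := by
      rw [← Matrix.transpose_mul, Matrix.nonsing_inv_mul _ hX, Matrix.transpose_one]
    have h2 : (X.submatrix id (Subtype.val : {j : IdxN q q₁ q₂ // j ≠ Sum.inl ⟨0, hq⟩} → _))ᵀ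
        * X⁻¹ᵀ.submatrix id (Subtype.val : {j : IdxN q q₁ q₂ // j ≠ Sum.inl ⟨0, hq⟩} → _)
        = (Xᵀ * X⁻¹ᵀ).submatrix Subtype.val Subtype.val := rfl
    rw [h2, h1]
    exact Matrix.submatrix_one _ Subtype.val_injective
  have hRinv' : Ry * (X₂ᵀ * Qy) = 1 := mul_eq_one_comm.1 hRinv
  have hQn := specNorm_isom' Qy hQy
  have hR1 : specNorm Ry ≤ specNorm X⁻¹ := by
    have h1 : Ry = Qyᵀ * Y₂ := by rw [hQR, ← Matrix.mul_assoc, hQy, Matrix.one_mul]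
    have h2 : specNorm Y₂ ≤ specNorm X⁻¹ := by
      rw [hY₂, ← specNorm_transpose' X⁻¹]
      exact specNorm_cols' _ _ Subtype.val_injective
    rw [h1]
    refine (specNorm_mul' _ _).trans ?_
    rw [specNorm_transpose']
    nlinarith [specNorm_nonneg' Qy, specNorm_nonneg' Y₂]
  set S := X₂ᵀ * Qy with hS
  have hR2 : specNorm S ≤ specNorm X := by
    have h2 : specNorm X₂ ≤ specNorm X := by
      rw [hX₂]
      exact specNorm_cols' _ _ Subtype.val_injective
    refine (specNorm_mul' _ _).trans ?_
    rw [specNorm_transpose']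
    nlinarith [specNorm_nonneg' Qy, specNorm_nonneg' X₂]
  have hDD : Matrix.diagonal d * Matrix.diagonal (fun j => (d j)⁻¹) = 1 := by
    rw [Matrix.diagonal_mul_diagonal, ← Matrix.diagonal_one]
    congr 1; funext j; exact mul_inv_cancel₀ (hd0 j)
  have hRS' : Ryᵀ * Sᵀ = 1 := by rw [← Matrix.transpose_mul, hRinv, Matrix.transpose_one]
  set E := Matrix.diagonal (fun j => (d j)⁻¹) with hE
  have hprod : (Ry * M' * Ryᵀ) * (Sᵀ * E * S) = 1 := by
    calc (Ry * M' * Ryᵀ) * (Sᵀ * E * S)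
        = Ry * M' * (Ryᵀ * Sᵀ) * E * S := by simp only [Matrix.mul_assoc]
      _ = Ry * (M' * E) * S := by rw [hRS', Matrix.mul_one]; simp only [Matrix.mul_assoc]
      _ = 1 := by rw [hM, hDD, Matrix.mul_one, hRinv']
  refine ⟨IsUnit.of_mul_eq_one _ hprod, ?_⟩
  have hinv : (Ry * M' * Ryᵀ)⁻¹ = Sᵀ * E * S := Matrix.inv_eq_right_inv hprod
  have hb1 : specNorm (Ry * M' * Ryᵀ) ≤ specNorm X⁻¹ * K * specNorm X⁻¹ := by
    have hDn : specNorm M' ≤ K := by rw [hM]; exact specNorm_diagonal' d K hK0.le hup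
    have := specNorm_nonneg' M'
    have := specNorm_nonneg' Ry
    have := specNorm_nonneg' X⁻¹
    calc _ ≤ specNorm (Ry * M') * specNorm Ryᵀ := specNorm_mul' _ _
      _ ≤ (specNorm Ry * specNorm M') * specNorm Ryᵀ :=
        mul_le_mul_of_nonneg_right (specNorm_mul' _ _) (specNorm_nonneg' _)
      _ = specNorm Ry * specNorm M' * specNorm Ry := by rw [specNorm_transpose' Ry]
      _ ≤ _ := by gcongr
  have hb2 : specNorm (Sᵀ * E * S) ≤ specNorm X * (min |dm| m)⁻¹ * specNorm X := by
    have hDn : specNorm E ≤ (min |dm| m)⁻¹ := by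
      refine specNorm_diagonal' _ _ (inv_nonneg.2 hmin0.le) fun j => ?_
      rw [abs_inv]
      exact inv_anti₀ hmin0 (hlow j)
    have := specNorm_nonneg' E
    have := specNorm_nonneg' S
    have := specNorm_nonneg' X
    calc _ ≤ specNorm (Sᵀ * E) * specNorm S := specNorm_mul' _ _
      _ ≤ (specNorm Sᵀ * specNorm E) * specNorm S :=
        mul_le_mul_of_nonneg_right (specNorm_mul' _ _) (specNorm_nonneg' _)
      _ = specNorm S * specNorm E * specNorm S := by rw [specNorm_transpose' S]
      _ ≤ _ := by gcongr
  unfold specCond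
  rw [hinv]
  have hx := specNorm_nonneg' X⁻¹
  calc _ ≤ (specNorm X⁻¹ * K * specNorm X⁻¹) * (specNorm X * (min |dm| m)⁻¹ * specNorm X) :=
        mul_le_mul hb1 hb2 (specNorm_nonneg' _) (by positivity)
    _ = (specNorm X * specNorm X⁻¹) ^ 2 * (K * (min |dm| m)⁻¹) := by ring
    _ ≤ _ := mul_le_mul_of_nonneg_left hKF (sq_nonneg _)
end

section
/- Let θ > 0 satisfy θ ≠ σ_i for all i = 1,…,q. Then the matrix A^TA − θ²B^TB is invertible, and with L = (A^TA − θ²B^TB)^{-1} and K = L(A^TA + B^TB) the following hold: (a) K x_i = ((σ_i² + 1)/(σ_i² − θ²)) x_i for i = 1,…,q; (b) K x_j = −(1/θ²) x_j for every column x_j of X with index j ∈ {q+1,…,q+q₁} (the columns satisfying A x_j = 0); (c) K x_j = x_j for every column x_j of X with index j ∈ {q+q₁+1,…,n} (the columns satisfying B x_j = 0). -/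
open Matrix

theorem stmt13 {q q₁ q₂ l₁ l₂ : ℕ}
    (A : Matrix (IdxM q l₁ q₂) (IdxN q q₁ q₂) ℝ)
    (B : Matrix (IdxP q q₁ l₂) (IdxN q q₁ q₂) ℝ)
    (U : Matrix (IdxM q l₁ q₂) (IdxM q l₁ q₂) ℝ)
    (V : Matrix (IdxP q q₁ l₂) (IdxP q q₁ l₂) ℝ)
    (X : Matrix (IdxN q q₁ q₂) (IdxN q q₁ q₂) ℝ)
    (α β : Fin q → ℝ)
    (hαpos : ∀ i, 0 < α i) (hα1 : ∀ i, α i < 1)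
    (hβpos : ∀ i, 0 < β i) (hβ1 : ∀ i, β i < 1)
    (hαβ : ∀ i, α i ^ 2 + β i ^ 2 = 1)
    (hU : Uᵀ * U = 1) (hV : Vᵀ * V = 1) (hX : IsUnit X.det)
    (hA : Uᵀ * A * X = SigmaA q q₁ q₂ l₁ α)
    (hB : Vᵀ * B * X = SigmaB q q₁ q₂ l₂ β)
    (θ : ℝ) (hθ : 0 < θ) (hθσ : ∀ i : Fin q, θ ≠ α i / β i)
    (L K : Matrix (IdxN q q₁ q₂) (IdxN q q₁ q₂) ℝ)
    (hL : L = (Aᵀ * A - θ ^ 2 • (Bᵀ * B))⁻¹)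
    (hK : K = L * (Aᵀ * A + Bᵀ * B)) :
    IsUnit (Aᵀ * A - θ ^ 2 • (Bᵀ * B)) ∧
    (∀ i : Fin q,
      K.mulVec (fun s => X s (Sum.inl i)) =
        (((α i / β i) ^ 2 + 1) / ((α i / β i) ^ 2 - θ ^ 2)) •
          (fun s => X s (Sum.inl i))) ∧
    (∀ j : Fin q₁,
      K.mulVec (fun s => X s (Sum.inr (Sum.inl j))) =
        (-(1 / θ ^ 2)) • (fun s => X s (Sum.inr (Sum.inl j)))) ∧
    (∀ j : Fin q₂,
      K.mulVec (fun s => X s (Sum.inr (Sum.inr j))) =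
        (fun s => X s (Sum.inr (Sum.inr j)))) := by
  have hU' : U * Uᵀ = 1 := mul_eq_one_comm.mp hU
  have hV' : V * Vᵀ = 1 := mul_eq_one_comm.mp hV
  have hAA : Xᵀ * (Aᵀ * A) * X
      = diagonal (Sum.elim (fun i => α i ^ 2) (Sum.elim (fun _ => 0) (fun _ => 1))) := by
    have h : (Uᵀ * A * X)ᵀ * (Uᵀ * A * X) = Xᵀ * (Aᵀ * A) * X := by
      simp only [transpose_mul, transpose_transpose]
      calc Xᵀ * (Aᵀ * U) * (Uᵀ * A * X) = Xᵀ * (Aᵀ * (U * Uᵀ) * A) * X := by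
            simp only [Matrix.mul_assoc]
        _ = _ := by rw [hU', Matrix.mul_one]
    rw [← h, hA, SigmaA]
    simp only [fromBlocks_transpose, fromBlocks_multiply]
    ext i j
    rcases i with i | i | i <;> rcases j with j | j | j <;>
      simp [diagonal_apply, one_apply, pow_two]
  have hBB : Xᵀ * (Bᵀ * B) * X
      = diagonal (Sum.elim (fun i => β i ^ 2) (Sum.elim (fun _ => 1) (fun _ => 0))) := by
    have h : (Vᵀ * B * X)ᵀ * (Vᵀ * B * X) = Xᵀ * (Bᵀ * B) * X := by
      simp only [transpose_mul, transpose_transpose]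
      calc Xᵀ * (Bᵀ * V) * (Vᵀ * B * X) = Xᵀ * (Bᵀ * (V * Vᵀ) * B) * X := by
            simp only [Matrix.mul_assoc]
        _ = _ := by rw [hV', Matrix.mul_one]
    rw [← h, hB, SigmaB]
    simp only [fromBlocks_transpose, fromBlocks_multiply]
    ext i j
    rcases i with i | i | i <;> rcases j with j | j | j <;>
      simp [diagonal_apply, one_apply, pow_two]
  set M := Aᵀ * A - θ ^ 2 • (Bᵀ * B) with hM
  set N := Aᵀ * A + Bᵀ * B with hN
  have hne : ∀ i, α i ^ 2 - θ ^ 2 * β i ^ 2 ≠ 0 := by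
    intro i h
    apply hθσ i
    rw [eq_div_iff (hβpos i).ne']
    have h2 : (θ * β i) ^ 2 = α i ^ 2 := by linarith [mul_pow θ (β i) 2]
    exact (pow_left_inj₀ (mul_pos hθ (hβpos i)).le (hαpos i).le two_ne_zero).mp h2
  let d : IdxN q q₁ q₂ → ℝ := Sum.elim (fun i => α i ^ 2 - θ ^ 2 * β i ^ 2)
    (Sum.elim (fun _ => - θ ^ 2) (fun _ => 1))
  have hd : ∀ i, d i ≠ 0 := by
    rintro (i | i | i)
    · exact hne i
    · simp [d, hθ.ne']
    · simp [d]
  have hMX : Xᵀ * M * X = diagonal d := by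
    rw [hM, Matrix.mul_sub, Matrix.sub_mul, Matrix.mul_smul, Matrix.smul_mul, hAA, hBB]
    ext i j
    rcases i with i | i | i <;> rcases j with j | j | j <;>
      simp [diagonal_apply, d] <;> split_ifs <;> simp
  have hNX : Xᵀ * N * X = 1 := by
    rw [hN, Matrix.mul_add, Matrix.add_mul, hAA, hBB]
    ext i j
    rcases i with i | i | i <;> rcases j with j | j | j <;>
      simp [diagonal_apply, one_apply]
    split_ifs <;> simp [hαβ]
  have hXu : IsUnit X := (isUnit_iff_isUnit_det X).mpr hX
  have hXt : IsUnit Xᵀ := (isUnit_iff_isUnit_det Xᵀ).mpr (by rwa [det_transpose])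
  have hMdet : IsUnit M.det := by
    have h := congrArg det hMX
    rw [det_mul, det_mul, det_diagonal] at h
    refine isUnit_iff_ne_zero.mpr fun h0 => ?_
    rw [h0, mul_zero, zero_mul] at h
    exact Finset.prod_ne_zero_iff.mpr (fun i _ => hd i) h.symm
  have hNM : N * X = M * X * diagonal (fun i => (d i)⁻¹) := by
    apply hXt.mul_left_cancel
    rw [← Matrix.mul_assoc, hNX, ← Matrix.mul_assoc, ← Matrix.mul_assoc, hMX, diagonal_mul_diagonal]
    simp [hd]
  have hKX : K * X = X * diagonal (fun i => (d i)⁻¹) := by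
    rw [hK, hL, Matrix.mul_assoc, hNM, Matrix.mul_assoc, nonsing_inv_mul_cancel_left _ _ hMdet]
  have key : ∀ j, K.mulVec (fun s => X s j) = (d j)⁻¹ • (fun s => X s j) := by
    intro j
    ext s
    have h := congrFun (congrFun hKX s) j
    rw [mul_diagonal, mul_apply] at h
    simp only [mulVec, dotProduct, Pi.smul_apply, smul_eq_mul]
    rw [h, mul_comm]
  refine ⟨(isUnit_iff_isUnit_det M).mpr hMdet, fun i => ?_, fun j => ?_, fun j => ?_⟩
  · rw [key]
    congr 1
    have hb := (hβpos i).ne'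
    have h1 : (α i / β i) ^ 2 + 1 = 1 / β i ^ 2 := by
      field_simp; exact hαβ i
    have h2 : (α i / β i) ^ 2 - θ ^ 2 = (α i ^ 2 - θ ^ 2 * β i ^ 2) / β i ^ 2 := by
      field_simp
    have := hne i
    rw [h1, h2]
    simp only [d, Sum.elim_inl]
    field_simp
  · rw [key]
    congr 1
    simp [d]
  · rw [key]
    simp [d]
end

section
/- The vector t := (1/θ)(−x̃ + ν L ỹ) satisfies ỹ^T t = 0 and (I − ỹ x̃^T)(A^TA − θ² B^TB)(I − x̃ ỹ^T) t = −r, and it is the unique vector in ℝⁿ with these two properties. -/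
open Matrix

theorem stmt14 {m n p : ℕ} (A : Matrix (Fin m) (Fin n) ℝ) (B : Matrix (Fin p) (Fin n) ℝ)
    (θ : ℝ) (hθ : 0 < θ) (hInv : IsUnit (Aᵀ * A - θ ^ 2 • (Bᵀ * B)))
    (L : Matrix (Fin n) (Fin n) ℝ) (hL : L = (Aᵀ * A - θ ^ 2 • (Bᵀ * B))⁻¹)
    (xt yt : Fin n → ℝ) (hyt : yt = (Aᵀ * A + Bᵀ * B).mulVec xt)
    (hyx : yt ⬝ᵥ xt = 1) (hyLy : yt ⬝ᵥ L.mulVec yt ≠ 0)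
    (ν : ℝ) (hν : ν = 1 / (yt ⬝ᵥ L.mulVec yt))
    (r : Fin n → ℝ) (hr : r = θ⁻¹ • (Aᵀ * A - θ ^ 2 • (Bᵀ * B)).mulVec xt)
    (hxr : xt ⬝ᵥ r = 0)
    (t : Fin n → ℝ) (ht : t = θ⁻¹ • (-xt + ν • L.mulVec yt)) :
    (yt ⬝ᵥ t = 0 ∧
      ((1 - vecMulVec yt xt) * (Aᵀ * A - θ ^ 2 • (Bᵀ * B)) *
        (1 - vecMulVec xt yt)).mulVec t = -r) ∧
    ∀ t' : Fin n → ℝ, yt ⬝ᵥ t' = 0 →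
      ((1 - vecMulVec yt xt) * (Aᵀ * A - θ ^ 2 • (Bᵀ * B)) *
        (1 - vecMulVec xt yt)).mulVec t' = -r → t' = t := by
  generalize (Aᵀ * A - θ ^ 2 • (Bᵀ * B)) = M at *
  have hdet : IsUnit M.det := (Matrix.isUnit_iff_isUnit_det M).1 hInv
  have hML : ∀ v, M.mulVec (L.mulVec v) = v := fun v => by
    rw [hL, mulVec_mulVec, mul_nonsing_inv _ hdet, one_mulVec]
  have hLM : ∀ v, L.mulVec (M.mulVec v) = v := fun v => by
    rw [hL, mulVec_mulVec, nonsing_inv_mul _ hdet, one_mulVec]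
  have hxy : xt ⬝ᵥ yt = 1 := by rw [dotProduct_comm]; exact hyx
  have hop : ∀ v, yt ⬝ᵥ v = 0 → ((1 - vecMulVec yt xt) * M * (1 - vecMulVec xt yt)).mulVec v
      = M.mulVec v - (xt ⬝ᵥ M.mulVec v) • yt := by
    intro v hv
    have h1 : (1 - vecMulVec xt yt).mulVec v = v := by
      rw [sub_mulVec, one_mulVec, vecMulVec_mulVec, hv]; simp
    rw [← mulVec_mulVec, h1, ← mulVec_mulVec, sub_mulVec, one_mulVec, vecMulVec_mulVec]
    simp
  have hνk : ν * (yt ⬝ᵥ L.mulVec yt) = 1 := by rw [hν]; field_simp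
  have hyt0 : yt ⬝ᵥ t = 0 := by
    rw [ht, dotProduct_smul, dotProduct_add, dotProduct_neg, dotProduct_smul, hyx, smul_eq_mul,
      smul_eq_mul, hνk]; simp
  have hMt : M.mulVec t = -r + (θ⁻¹ * ν) • yt := by
    rw [ht, mulVec_smul, mulVec_add, mulVec_neg, mulVec_smul, hML, hr, smul_add, smul_neg, smul_smul]
  refine ⟨⟨hyt0, ?_⟩, ?_⟩
  · rw [hop t hyt0, hMt, dotProduct_add, dotProduct_neg, hxr, dotProduct_smul, hxy]
    simp
  · intro t' h0 h1
    rw [hop t' h0] at h1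
    generalize xt ⬝ᵥ M.mulVec t' = c at h1
    have h2 : M.mulVec t' = -r + c • yt := by rw [← h1]; abel
    have h3 : t' = -(θ⁻¹ • xt) + c • L.mulVec yt := by
      rw [← hLM t', h2, mulVec_add, mulVec_neg, mulVec_smul, hr, mulVec_smul, hLM]
    have h4 : c * (yt ⬝ᵥ L.mulVec yt) = θ⁻¹ := by
      rw [h3, dotProduct_add, dotProduct_neg, dotProduct_smul, dotProduct_smul, hyx] at h0
      simp only [smul_eq_mul] at h0
      linarith
    have h5 : c = θ⁻¹ * ν := by
      apply mul_right_cancel₀ hyLy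
      rw [h4, mul_assoc, hνk, mul_one]
    rw [h3, ht, h5, smul_add, smul_neg, smul_smul]
end

section
/- Let 1 ≤ j < q, let X_j, U_j, V_j consist of the first j columns of X, U, V respectively, let C_j = diag(α₁,…,α_j) and S_j = diag(β₁,…,β_j), and set Y_j = (A^TA + B^TB)X_j. Then Y_j = A^T U_j C_j + B^T V_j S_j, and for every i ∈ {j+1,…,q}: Y_j^T x_i = 0, and with A_j := A(I − X_j Y_j^T) and B_j := B(I − X_j Y_j^T) one has A_j x_i = α_i u_i and B_j x_i = β_i v_i. -/
open Matrix

theorem stmt18 {q q₁ q₂ l₁ l₂ : ℕ}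
    (A : Matrix (IdxM q l₁ q₂) (IdxN q q₁ q₂) ℝ)
    (B : Matrix (IdxP q q₁ l₂) (IdxN q q₁ q₂) ℝ)
    (U : Matrix (IdxM q l₁ q₂) (IdxM q l₁ q₂) ℝ)
    (V : Matrix (IdxP q q₁ l₂) (IdxP q q₁ l₂) ℝ)
    (X : Matrix (IdxN q q₁ q₂) (IdxN q q₁ q₂) ℝ)
    (α β : Fin q → ℝ)
    (hαpos : ∀ i, 0 < α i) (hα1 : ∀ i, α i < 1)
    (hβpos : ∀ i, 0 < β i) (hβ1 : ∀ i, β i < 1)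
    (hαβ : ∀ i, α i ^ 2 + β i ^ 2 = 1)
    (hU : Uᵀ * U = 1) (hV : Vᵀ * V = 1) (hX : IsUnit X.det)
    (hA : Uᵀ * A * X = SigmaA q q₁ q₂ l₁ α)
    (hB : Vᵀ * B * X = SigmaB q q₁ q₂ l₂ β)
    (j : ℕ) (hj1 : 1 ≤ j) (hjq : j < q)
    (Xj : Matrix (IdxN q q₁ q₂) (Fin j) ℝ)
    (hXj : Xj = Matrix.of fun s (i' : Fin j) => X s (Sum.inl (Fin.castLE hjq.le i')))
    (Uj : Matrix (IdxM q l₁ q₂) (Fin j) ℝ)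
    (hUj : Uj = Matrix.of fun s (i' : Fin j) => U s (Sum.inl (Fin.castLE hjq.le i')))
    (Vj : Matrix (IdxP q q₁ l₂) (Fin j) ℝ)
    (hVj : Vj = Matrix.of fun s (i' : Fin j) => V s (Sum.inl (Fin.castLE hjq.le i')))
    (Cj Sj : Matrix (Fin j) (Fin j) ℝ)
    (hCj : Cj = Matrix.diagonal fun i' : Fin j => α (Fin.castLE hjq.le i'))
    (hSj : Sj = Matrix.diagonal fun i' : Fin j => β (Fin.castLE hjq.le i'))
    (Yj : Matrix (IdxN q q₁ q₂) (Fin j) ℝ) (hYj : Yj = (Aᵀ * A + Bᵀ * B) * Xj) :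
    Yj = Aᵀ * Uj * Cj + Bᵀ * Vj * Sj ∧
    ∀ i : Fin q, j ≤ (i : ℕ) →
      Yjᵀ.mulVec (fun s => X s (Sum.inl i)) = 0 ∧
      (A * (1 - Xj * Yjᵀ)).mulVec (fun s => X s (Sum.inl i)) =
        α i • (fun s => U s (Sum.inl i)) ∧
      (B * (1 - Xj * Yjᵀ)).mulVec (fun s => X s (Sum.inl i)) =
        β i • (fun s => V s (Sum.inl i)) := by
  have hU' : U * Uᵀ = 1 := mul_eq_one_comm.mp hU
  have hV' : V * Vᵀ = 1 := mul_eq_one_comm.mp hV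
  have hAX : A * X = U * SigmaA q q₁ q₂ l₁ α := by
    rw [← hA, Matrix.mul_assoc, ← Matrix.mul_assoc U, hU', Matrix.one_mul]
  have hBX : B * X = V * SigmaB q q₁ q₂ l₂ β := by
    rw [← hB, Matrix.mul_assoc, ← Matrix.mul_assoc V, hV', Matrix.one_mul]
  have hAx : ∀ i : Fin q, A.mulVec (fun s => X s (Sum.inl i)) =
      α i • (fun s => U s (Sum.inl i)) := by
    intro i
    funext s
    have h := congrFun (congrFun hAX s) (Sum.inl i)
    have h2 : (U * SigmaA q q₁ q₂ l₁ α) s (Sum.inl i) = α i * U s (Sum.inl i) := by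
      simp [Matrix.mul_apply, SigmaA, Fintype.sum_sum_type, Matrix.diagonal_apply, mul_comm]
    exact h.trans h2
  have hBx : ∀ i : Fin q, B.mulVec (fun s => X s (Sum.inl i)) =
      β i • (fun s => V s (Sum.inl i)) := by
    intro i
    funext s
    have h := congrFun (congrFun hBX s) (Sum.inl i)
    have h2 : (V * SigmaB q q₁ q₂ l₂ β) s (Sum.inl i) = β i * V s (Sum.inl i) := by
      simp [Matrix.mul_apply, SigmaB, Fintype.sum_sum_type, Matrix.diagonal_apply, mul_comm]
    exact h.trans h2
  have hAXj : A * Xj = Uj * Cj := by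
    ext s k
    have h := congrFun (hAx (Fin.castLE hjq.le k)) s
    rw [hCj, Matrix.mul_diagonal, hXj, hUj]
    refine Eq.trans h ?_
    simp [mul_comm]
  have hBXj : B * Xj = Vj * Sj := by
    ext s k
    have h := congrFun (hBx (Fin.castLE hjq.le k)) s
    rw [hSj, Matrix.mul_diagonal, hXj, hVj]
    refine Eq.trans h ?_
    simp [mul_comm]
  have hY : Yj = Aᵀ * Uj * Cj + Bᵀ * Vj * Sj := by
    rw [hYj, Matrix.add_mul, Matrix.mul_assoc, Matrix.mul_assoc, hAXj, hBXj,
      Matrix.mul_assoc, Matrix.mul_assoc]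
  refine ⟨hY, fun i hi => ?_⟩
  have hne : ∀ k : Fin j, Fin.castLE hjq.le k ≠ i := by
    intro k hk
    have h1 := congrArg Fin.val hk
    have h2 := k.isLt
    simp at h1
    omega
  have hUu : Ujᵀ.mulVec (fun s => U s (Sum.inl i)) = 0 := by
    funext k
    have h := congrFun (congrFun hU (Sum.inl (Fin.castLE hjq.le k))) (Sum.inl i)
    rw [Matrix.one_apply_ne (by simpa using hne k)] at h
    rw [hUj]
    exact h
  have hVv : Vjᵀ.mulVec (fun s => V s (Sum.inl i)) = 0 := by
    funext k
    have h := congrFun (congrFun hV (Sum.inl (Fin.castLE hjq.le k))) (Sum.inl i)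
    rw [Matrix.one_apply_ne (by simpa using hne k)] at h
    rw [hVj]
    exact h
  have hYx : Yjᵀ.mulVec (fun s => X s (Sum.inl i)) = 0 := by
    rw [hY]
    simp only [Matrix.transpose_add, Matrix.transpose_mul, Matrix.transpose_transpose,
      Matrix.add_mulVec, ← Matrix.mulVec_mulVec, hAx, hBx, Matrix.mulVec_smul, hUu, hVv,
      Matrix.mulVec_zero, smul_zero, add_zero]
  refine ⟨hYx, ?_, ?_⟩
  · rw [← Matrix.mulVec_mulVec, Matrix.sub_mulVec, ← Matrix.mulVec_mulVec, hYx,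
      Matrix.mulVec_zero, sub_zero, Matrix.one_mulVec, hAx]
  · rw [← Matrix.mulVec_mulVec, Matrix.sub_mulVec, ← Matrix.mulVec_mulVec, hYx,
      Matrix.mulVec_zero, sub_zero, Matrix.one_mulVec, hBx]
end

section
/- Let A ∈ ℝ^{m×n}, B ∈ ℝ^{p×n}, let X̃ ∈ ℝ^{n×k} satisfy X̃^TX̃ = I_k, and suppose AX̃ = ŨG and BX̃ = ṼH with Ũ^TŨ = Ṽ^TṼ = I_k and G, H ∈ ℝ^{k×k}. Let D ∈ ℝ^{k×k} satisfy D^T(G^TG + H^TH)D = I_k, write D = [d, D₂] with d its first column and D₂ ∈ ℝ^{k×(k−1)}, and set x̃ = X̃d and ỹ = (A^TA + B^TB)x̃. Then D₂^T X̃^T ỹ = 0; that is, every column of X̃D₂ is orthogonal to ỹ. -/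
open Matrix

theorem stmt19 {m n p k : ℕ} (A : Matrix (Fin m) (Fin n) ℝ) (B : Matrix (Fin p) (Fin n) ℝ)
    (Xt : Matrix (Fin n) (Fin (k + 1)) ℝ)
    (Ut : Matrix (Fin m) (Fin (k + 1)) ℝ) (Vt : Matrix (Fin p) (Fin (k + 1)) ℝ)
    (G H : Matrix (Fin (k + 1)) (Fin (k + 1)) ℝ)
    (hXt : Xtᵀ * Xt = 1) (hUt : Utᵀ * Ut = 1) (hVt : Vtᵀ * Vt = 1)
    (hAX : A * Xt = Ut * G) (hBX : B * Xt = Vt * H)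
    (D : Matrix (Fin (k + 1)) (Fin (k + 1)) ℝ)
    (hD : Dᵀ * (Gᵀ * G + Hᵀ * H) * D = 1)
    (d : Fin (k + 1) → ℝ) (hd : d = fun i => D i 0)
    (D₂ : Matrix (Fin (k + 1)) (Fin k) ℝ)
    (hD₂ : D₂ = Matrix.of fun i (j : Fin k) => D i j.succ)
    (xt yt : Fin n → ℝ) (hxt : xt = Xt.mulVec d)
    (hyt : yt = (Aᵀ * A + Bᵀ * B).mulVec xt) :
    D₂ᵀ.mulVec (Xtᵀ.mulVec yt) = 0 := by
  have key : ∀ {q : ℕ} (M : Matrix (Fin q) (Fin n) ℝ) (W : Matrix (Fin q) (Fin (k + 1)) ℝ)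
      (K : Matrix (Fin (k + 1)) (Fin (k + 1)) ℝ), Wᵀ * W = 1 → M * Xt = W * K →
      Xtᵀ * (Mᵀ * M) * Xt = Kᵀ * K := by
    intro q M W K hW hM
    calc Xtᵀ * (Mᵀ * M) * Xt = (M * Xt)ᵀ * (M * Xt) := by
          simp only [Matrix.transpose_mul, Matrix.mul_assoc]
      _ = Kᵀ * ((Wᵀ * W) * K) := by
          rw [hM]; simp only [Matrix.transpose_mul, Matrix.mul_assoc]
      _ = Kᵀ * K := by rw [hW, Matrix.one_mul]
  have hS : Xtᵀ * (Aᵀ * A + Bᵀ * B) * Xt = Gᵀ * G + Hᵀ * H := by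
    rw [Matrix.mul_add, Matrix.add_mul, key A Ut G hUt hAX, key B Vt H hVt hBX]
  have hy : Xtᵀ.mulVec yt = (Gᵀ * G + Hᵀ * H).mulVec d := by
    rw [hyt, hxt, ← hS]
    simp only [Matrix.mulVec_mulVec, Matrix.mul_assoc]
  rw [hy, Matrix.mulVec_mulVec]
  ext j
  have h := congrFun (congrFun hD j.succ) 0
  rw [Matrix.one_apply_ne (Fin.succ_ne_zero j)] at h
  subst hd hD₂
  exact h
end
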